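/- Let (X,M,*) be a fuzzy metric space in which every subset of X that is closed and discrete in (X,τ_M) is fuzzy uniformly discrete in (X,M,*). Then the set X' of all accumulation points of (X,τ_M) is compact, and for every r ∈ (0,1) and s > 0 the set X \ B(X',r,s) is fuzzy uniformly discrete in (X,M,*), where B(X',r,s) = ⋃_{a∈X'} B(a,r,s). -/

import Mathlib

open Filter Topology Set

/-- A fuzzy metric space in the sense of George and Veeramani: a continuous
t-norm `star` on `[0,1]` together with a fuzzy set `M` on `X × X × (0,∞)`. -/
structure FuzzyMetric (X : Type*) where
  M : X → X → ℝ → ℝ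
  star : ℝ → ℝ → ℝ
  star_mem : ∀ a ∈ Set.Icc (0:ℝ) 1, ∀ b ∈ Set.Icc (0:ℝ) 1, star a b ∈ Set.Icc (0:ℝ) 1
  star_comm : ∀ a ∈ Set.Icc (0:ℝ) 1, ∀ b ∈ Set.Icc (0:ℝ) 1, star a b = star b a
  star_assoc : ∀ a ∈ Set.Icc (0:ℝ) 1, ∀ b ∈ Set.Icc (0:ℝ) 1, ∀ c ∈ Set.Icc (0:ℝ) 1,
    star (star a b) c = star a (star b c)
  star_one : ∀ a ∈ Set.Icc (0:ℝ) 1, star a 1 = a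
  star_mono : ∀ a b c d : ℝ, a ∈ Set.Icc (0:ℝ) 1 → b ∈ Set.Icc (0:ℝ) 1 →
    c ∈ Set.Icc (0:ℝ) 1 → d ∈ Set.Icc (0:ℝ) 1 → a ≤ b → c ≤ d → star a c ≤ star b d
  star_continuous : ContinuousOn (fun p : ℝ × ℝ => star p.1 p.2)
    (Set.Icc (0:ℝ) 1 ×ˢ Set.Icc (0:ℝ) 1)
  M_pos : ∀ x y t, 0 < t → 0 < M x y t
  M_le_one : ∀ x y t, 0 < t → M x y t ≤ 1
  M_eq_one_iff : ∀ x y t, 0 < t → (M x y t = 1 ↔ x = y)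
  M_symm : ∀ x y t, 0 < t → M x y t = M y x t
  M_triangle : ∀ x y z t s, 0 < t → 0 < s → star (M x y t) (M y z s) ≤ M x z (t + s)
  M_continuousOn : ∀ x y, ContinuousOn (M x y) (Set.Ioi (0:ℝ))

namespace FuzzyMetric

variable {X : Type*}

/-- The open ball `B(x,r,t)`. -/
def ball (F : FuzzyMetric X) (x : X) (r t : ℝ) : Set X := {y | 1 - r < F.M x y t}

/-- The topology `τ_M` induced by the fuzzy metric (the balls form a base for it). -/
def topology (F : FuzzyMetric X) : TopologicalSpace X :=
  TopologicalSpace.generateFrom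
    {s | ∃ x : X, ∃ r t : ℝ, r ∈ Set.Ioo (0:ℝ) 1 ∧ 0 < t ∧ s = F.ball x r t}

/-- `f : X → ℝ` is `ℝ`-uniformly continuous. -/
def RUniformlyContinuous (F : FuzzyMetric X) (f : X → ℝ) : Prop :=
  ∀ ε > (0:ℝ), ∃ r ∈ Set.Ioo (0:ℝ) 1, ∃ s > (0:ℝ),
    ∀ x y : X, 1 - r < F.M x y s → |f x - f y| < ε

/-- The Lebesgue property: every open cover is refined by the family of balls of
some fixed radius `r` and parameter `t`. -/
def Lebesgue (F : FuzzyMetric X) : Prop :=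
  ∀ 𝒢 : Set (Set X), (∀ G ∈ 𝒢, F.topology.IsOpen G) → ⋃₀ 𝒢 = Set.univ →
    ∃ r ∈ Set.Ioo (0:ℝ) 1, ∃ t > (0:ℝ), ∀ x : X, ∃ G ∈ 𝒢, F.ball x r t ⊆ G

/-- A set `A ⊆ X` is fuzzy uniformly discrete. -/
def UniformlyDiscrete (F : FuzzyMetric X) (A : Set X) : Prop :=
  ∃ r ∈ Set.Ioo (0:ℝ) 1, ∃ s > (0:ℝ), ∀ x ∈ A, ∀ y ∈ A, x ≠ y → F.M x y s < 1 - r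

/-- The set `X'` of accumulation points of `(X, τ_M)`. -/
def derivedSet (F : FuzzyMetric X) : Set X :=
  {x | ∀ U : Set X, F.topology.IsOpen U → x ∈ U → ∃ y ∈ U, y ≠ x}

/-- A sequence is Cauchy in the fuzzy metric. -/
def IsCauchy (F : FuzzyMetric X) (u : ℕ → X) : Prop :=
  ∀ ε ∈ Set.Ioo (0:ℝ) 1, ∀ t > (0:ℝ), ∃ k : ℕ, ∀ m ≥ k, ∀ n ≥ k, 1 - ε < F.M (u m) (u n) t

/-- Sequential compactness: every sequence has a convergent subsequence. -/
def SeqCompact (F : FuzzyMetric X) : Prop :=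
  ∀ u : ℕ → X, ∃ x : X, ∃ φ : ℕ → ℕ, StrictMono φ ∧
    Filter.Tendsto (u ∘ φ) Filter.atTop (@nhds X F.topology x)

end FuzzyMetric

namespace FuzzyMetric

variable {X : Type*}

lemma M_mem_Icc (F : FuzzyMetric X) (x y : X) {t : ℝ} (ht : 0 < t) :
    F.M x y t ∈ Set.Icc (0:ℝ) 1 :=
  ⟨(F.M_pos x y t ht).le, F.M_le_one x y t ht⟩

lemma M_self (F : FuzzyMetric X) (x : X) {t : ℝ} (ht : 0 < t) : F.M x x t = 1 :=
  (F.M_eq_one_iff x x t ht).2 rfl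

lemma M_mono (F : FuzzyMetric X) (x y : X) {s t : ℝ} (hs : 0 < s) (hst : s ≤ t) :
    F.M x y s ≤ F.M x y t := by
  rcases hst.eq_or_lt with rfl | hlt
  · exact le_rfl
  · have h := F.M_triangle x y y s (t - s) hs (sub_pos.2 hlt)
    rwa [F.M_self y (sub_pos.2 hlt), F.star_one _ (F.M_mem_Icc x y hs), add_sub_cancel] at h

lemma exists_lt_star (F : FuzzyMetric X) {a c : ℝ} (ha : a ∈ Set.Icc (0:ℝ) 1) (hc : c < a) :
    ∃ δ > (0:ℝ), ∀ u ∈ Set.Icc (0:ℝ) 1, ∀ v ∈ Set.Icc (0:ℝ) 1,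
      a - δ < u → 1 - δ < v → u ≤ a → c < F.star u v := by
  have h1 : (1:ℝ) ∈ Set.Icc (0:ℝ) 1 := ⟨zero_le_one, le_rfl⟩
  have hcont := F.star_continuous (a, 1) ⟨ha, h1⟩
  rw [Metric.continuousWithinAt_iff] at hcont
  obtain ⟨δ, hδ, h⟩ := hcont (a - c) (sub_pos.2 hc)
  refine ⟨δ, hδ, fun u hu v hv hua hv1 hle => ?_⟩
  have hd : dist (u, v) (a, (1:ℝ)) < δ := by
    rw [Prod.dist_eq, Real.dist_eq, Real.dist_eq, max_lt_iff, abs_lt, abs_lt]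
    have := hv.2
    exact ⟨⟨by linarith, by linarith⟩, by linarith, by linarith⟩
  have := h (x := (u, v)) ⟨hu, hv⟩ hd
  rw [Real.dist_eq, F.star_one a ha, abs_lt] at this
  linarith [this.1]

/-- The pairs that are `ε`-close, with `ε` serving both as radius and as parameter. -/
def entourage (F : FuzzyMetric X) (ε : ℝ) : Set (X × X) := {p | 1 - ε < F.M p.1 p.2 ε}

lemma entourage_mono (F : FuzzyMetric X) {ε δ : ℝ} (hε : 0 < ε) (h : ε ≤ δ) :
    F.entourage ε ⊆ F.entourage δ := fun p (hp : 1 - ε < F.M p.1 p.2 ε) =>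
  show 1 - δ < F.M p.1 p.2 δ by linarith [F.M_mono p.1 p.2 hε h]

/-- The filter generated by the sets `F.entourage ε` for `ε > 0`. -/
def uniformityFilter (F : FuzzyMetric X) : Filter (X × X) :=
  ⨅ n : ℕ, 𝓟 (F.entourage (1 / ((n : ℝ) + 2)))

lemma uniformityFilter_hasAntitoneBasis (F : FuzzyMetric X) :
    F.uniformityFilter.HasAntitoneBasis fun n : ℕ => F.entourage (1 / ((n : ℝ) + 2)) := by
  have hanti : Antitone fun n : ℕ => F.entourage (1 / ((n : ℝ) + 2)) := fun m n hmn =>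
    F.entourage_mono (by positivity) (by gcongr)
  exact ⟨hasBasis_iInf_principal hanti.directed_ge, hanti⟩

lemma setOf_lt_M_mem_uniformityFilter (F : FuzzyMetric X) {r t : ℝ} (hr : 0 < r) (ht : 0 < t) :
    {p : X × X | 1 - r < F.M p.1 p.2 t} ∈ F.uniformityFilter := by
  obtain ⟨n, hn⟩ := exists_nat_one_div_lt (lt_min hr ht)
  have hle : 1 / ((n : ℝ) + 2) ≤ 1 / ((n : ℝ) + 1) := by gcongr; norm_num
  have h := lt_min_iff.1 (hle.trans_lt hn)
  refine F.uniformityFilter_hasAntitoneBasis.1.mem_iff.2 ⟨n, trivial, fun p hp => ?_⟩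
  have hp' : 1 - 1 / ((n : ℝ) + 2) < F.M p.1 p.2 (1 / ((n : ℝ) + 2)) := hp
  have := F.M_mono p.1 p.2 (by positivity) h.2.le
  show 1 - r < F.M p.1 p.2 t
  linarith [h.1]

lemma isOpen_ball (F : FuzzyMetric X) (x : X) {r t : ℝ} (hr : r ∈ Set.Ioo (0:ℝ) 1) (ht : 0 < t) :
    F.topology.IsOpen (F.ball x r t) :=
  TopologicalSpace.GenerateOpen.basic _ ⟨x, r, t, hr, ht, rfl⟩

lemma mem_ball_self (F : FuzzyMetric X) (x : X) {r t : ℝ} (hr : 0 < r) (ht : 0 < t) :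
    x ∈ F.ball x r t := by
  show 1 - r < F.M x x t
  rw [F.M_self x ht]
  linarith

lemma ball_mem_comap_uniformityFilter (F : FuzzyMetric X) {x y : X} {r t : ℝ} (ht : 0 < t)
    (hy : y ∈ F.ball x r t) : F.ball x r t ∈ comap (Prod.mk y) F.uniformityFilter := by
  have hy' : 1 - r < F.M x y t := hy
  obtain ⟨s, hs, hs0, hst⟩ : ∃ s, 1 - r < F.M x y s ∧ 0 < s ∧ s < t := by
    have hev : ∀ᶠ s in 𝓝[<] t, 1 - r < F.M x y s :=
      (((F.M_continuousOn x y).continuousAt (Ioi_mem_nhds ht)).eventually_const_lt hy').filter_mono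
        nhdsWithin_le_nhds
    exact (hev.and (Ioo_mem_nhdsLT ht)).exists
  obtain ⟨δ, hδ, h⟩ := F.exists_lt_star (F.M_mem_Icc x y hs0) hs
  refine mem_of_superset
    (preimage_mem_comap (F.setOf_lt_M_mem_uniformityFilter hδ (sub_pos.2 hst))) fun z hz => ?_
  have hz' : 1 - δ < F.M y z (t - s) := hz
  have h1 := h _ (F.M_mem_Icc x y hs0) _ (F.M_mem_Icc y z (sub_pos.2 hst)) (by linarith) hz' le_rfl
  have h2 := F.M_triangle x y z s (t - s) hs0 (sub_pos.2 hst)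
  rw [add_sub_cancel] at h2
  exact h1.trans_le h2

lemma nhds_eq_comap_uniformityFilter (F : FuzzyMetric X) (x : X) :
    @nhds X F.topology x = comap (Prod.mk x) F.uniformityFilter := by
  let _ : TopologicalSpace X := F.topology
  refine le_antisymm ?_ ?_
  · refine ((F.uniformityFilter_hasAntitoneBasis.1.comap (Prod.mk x)).ge_iff).2 fun n _ => ?_
    have hn : (0:ℝ) < 1 / ((n : ℝ) + 2) := by positivity
    have hn1 : 1 / ((n : ℝ) + 2) < 1 := by
      rw [div_lt_one (by positivity)]
      linarith [(Nat.cast_nonneg n : (0:ℝ) ≤ n)]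
    exact IsOpen.mem_nhds (F.isOpen_ball x ⟨hn, hn1⟩ hn) (F.mem_ball_self x hn hn)
  · unfold topology
    rw [TopologicalSpace.nhds_generateFrom]
    refine le_iInf₂ fun s hs => le_principal_iff.2 ?_
    obtain ⟨hxs, y, r, t, -, ht, rfl⟩ := hs
    exact F.ball_mem_comap_uniformityFilter ht hxs

/-- The uniform structure inducing `F.topology`. -/
@[reducible]
def toUniformSpace (F : FuzzyMetric X) : UniformSpace X where
  toTopologicalSpace := F.topology
  uniformity := F.uniformityFilter
  symm := by
    refine (F.uniformityFilter_hasAntitoneBasis.1.tendsto_right_iff).2 fun n _ => ?_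
    have hn : (0:ℝ) < 1 / ((n : ℝ) + 2) := by positivity
    filter_upwards [F.setOf_lt_M_mem_uniformityFilter hn hn] with p hp
    show 1 - _ < F.M p.2 p.1 _
    rw [F.M_symm _ _ _ hn]
    exact hp
  comp := by
    intro s hs
    obtain ⟨n, -, hns⟩ := F.uniformityFilter_hasAntitoneBasis.1.mem_iff.1 hs
    have hn : (0:ℝ) < 1 / ((n : ℝ) + 2) := by positivity
    obtain ⟨δ, hδ, h⟩ := F.exists_lt_star (a := 1) (c := 1 - 1 / ((n : ℝ) + 2))
      ⟨zero_le_one, le_rfl⟩ (by linarith)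
    refine mem_of_superset
      (mem_lift' (F.setOf_lt_M_mem_uniformityFilter hδ (half_pos hn))) ?_
    rintro ⟨x, z⟩ ⟨y, hxy, hyz⟩
    refine hns ?_
    have h1 := h _ (F.M_mem_Icc x y (half_pos hn)) _ (F.M_mem_Icc y z (half_pos hn)) hxy hyz
      (F.M_le_one x y _ (half_pos hn))
    have h2 := F.M_triangle x y z _ _ (half_pos hn) (half_pos hn)
    rw [add_halves] at h2
    exact h1.trans_le h2
  nhds_eq_comap_uniformity := F.nhds_eq_comap_uniformityFilter

lemma t1Space (F : FuzzyMetric X) : @T1Space X F.topology := by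
  let _ : TopologicalSpace X := F.topology
  refine t1Space_iff_exists_open.2 fun x y hxy => ?_
  have hlt : F.M x y 1 < 1 := lt_of_le_of_ne (F.M_le_one x y 1 one_pos)
    fun h => hxy ((F.M_eq_one_iff x y 1 one_pos).1 h)
  have hpos := F.M_pos x y 1 one_pos
  have hr : 1 - F.M x y 1 ∈ Set.Ioo (0:ℝ) 1 := ⟨by linarith, by linarith⟩
  refine ⟨F.ball x (1 - F.M x y 1) 1, F.isOpen_ball x hr one_pos,
    F.mem_ball_self x hr.1 one_pos, fun h => ?_⟩
  have h' : 1 - (1 - F.M x y 1) < F.M x y 1 := h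
  linarith

lemma exists_isOpen_inter_eq_singleton (F : FuzzyMetric X) {A : Set X} {a : X} (ha : a ∈ A)
    (h : a ∉ F.derivedSet) : ∃ U : Set X, F.topology.IsOpen U ∧ U ∩ A = {a} := by
  simp only [derivedSet, Set.mem_ofPred_eq, not_forall, not_exists, not_and, not_not] at h
  obtain ⟨U, hU, haU, hsub⟩ := h
  exact ⟨U, hU, Set.Subset.antisymm (fun y hy => hsub y hy.1)
    (Set.singleton_subset_iff.2 ⟨haU, ha⟩)⟩

end FuzzyMetric

/-- In a uniform space, asymptotically close sequences have the same cluster points. -/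
lemma MapClusterPt.of_tendsto_uniformity {α ι : Type*} [UniformSpace α] {l : Filter ι}
    {u v : ι → α} {a : α} (hu : MapClusterPt a l u)
    (huv : Tendsto (fun i => (u i, v i)) l (uniformity α)) : MapClusterPt a l v := by
  rw [mapClusterPt_iff_frequently] at hu ⊢
  intro s hs
  obtain ⟨W, hW, hWs⟩ := UniformSpace.mem_nhds_iff.1 hs
  obtain ⟨V, hV, hVW⟩ := comp_mem_uniformity_sets hW
  refine ((hu _ (UniformSpace.ball_mem_nhds a hV)).and_eventually (huv hV)).mono fun i hi => ?_
  exact hWs (hVW ⟨u i, hi.1, hi.2⟩)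

/-- A point that is not a cluster point of a sequence in a T₁ space has a neighbourhood
meeting the range of the sequence at most in that point. -/
lemma eventually_nhds_notMem_range_diff {α : Type*} [TopologicalSpace α] [T1Space α]
    {u : ℕ → α} {a : α} (h : ¬ MapClusterPt a atTop u) :
    ∀ᶠ x in 𝓝 a, x ∉ Set.range u \ {a} := by
  simp only [mapClusterPt_iff_frequently, not_forall, not_frequently] at h
  obtain ⟨s, hs, hev⟩ := h
  obtain ⟨N, hN⟩ := eventually_atTop.1 hev
  have hfin : (u '' Set.Iio N \ {a}).Finite := ((Set.finite_Iio N).image u).sdiff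
  filter_upwards [hs, hfin.isClosed.isOpen_compl.mem_nhds (fun h => h.2 rfl)] with x hx hx'
  rintro ⟨⟨n, rfl⟩, hne⟩
  rcases lt_or_ge n N with hn | hn
  · exact hx' ⟨⟨n, hn, rfl⟩, hne⟩
  · exact hN n hn hx

/-- If every closed and discrete subset of `(X, τ_M)` is fuzzy uniformly discrete, then
the set `X'` of accumulation points is compact and, for every `r ∈ (0,1)` and `s > 0`,
the set `X \ B(X',r,s)` is fuzzy uniformly discrete. -/
theorem derivedSet_compact_of_closed_discrete {X : Type*} [Nonempty X] (F : FuzzyMetric X)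
    (h : ∀ A : Set X, @IsClosed X F.topology A →
      (∀ a ∈ A, ∃ U : Set X, F.topology.IsOpen U ∧ U ∩ A = {a}) →
      F.UniformlyDiscrete A) :
    @IsCompact X F.topology F.derivedSet ∧
      ∀ r ∈ Set.Ioo (0:ℝ) 1, ∀ s > (0:ℝ),
        F.UniformlyDiscrete ((⋃ a ∈ F.derivedSet, F.ball a r s)ᶜ) := by
  refine ⟨?_, fun r hr s hs => ?_⟩
  · let _ : UniformSpace X := F.toUniformSpace
    have _ : (uniformity X).IsCountablyGenerated :=
      F.uniformityFilter_hasAntitoneBasis.isCountablyGenerated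
    have _ : T1Space X := F.t1Space
    refine IsSeqCompact.isCompact fun u hu => ?_
    by_contra! hno
    have hclu : ∀ a, ¬ MapClusterPt a atTop u := by
      intro a ha
      by_cases had : a ∈ F.derivedSet
      · obtain ⟨φ, hφ, hlim⟩ := ha.tendsto_subseq
        exact hno a had φ hφ hlim
      · obtain ⟨U, hU, hUa⟩ := F.exists_isOpen_inter_eq_singleton (mem_univ a) had
        rw [inter_univ] at hUa
        subst hUa
        obtain ⟨n, hn⟩ := (mapClusterPt_iff_frequently.1 ha {a}
          (IsOpen.mem_nhds hU rfl)).exists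
        exact had (mem_singleton_iff.1 hn ▸ hu n)
    have hy : ∀ n : ℕ, ∃ y, (u n, y) ∈ F.entourage (1 / ((n : ℝ) + 2)) ∧ y ≠ u n := by
      intro n
      have hn : (0:ℝ) < 1 / ((n : ℝ) + 2) := by positivity
      have hn1 : 1 / ((n : ℝ) + 2) < 1 := by
        rw [div_lt_one (by positivity)]
        linarith [(Nat.cast_nonneg n : (0:ℝ) ≤ n)]
      exact hu n _ (F.isOpen_ball (u n) ⟨hn, hn1⟩ hn) (F.mem_ball_self _ hn hn)
    choose y hyu hne using hy
    have huy : Tendsto (fun n => (u n, y n)) atTop (uniformity X) :=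
      F.uniformityFilter_hasAntitoneBasis.tendsto hyu
    have hcly : ∀ a, ¬ MapClusterPt a atTop y := fun a ha =>
      hclu a (ha.of_tendsto_uniformity (tendsto_swap_uniformity.comp huy))
    have hnhds : ∀ a, ∀ᶠ x in 𝓝 a, x ∈ range u ∪ range y → x = a := by
      intro a
      filter_upwards [eventually_nhds_notMem_range_diff (hclu a),
        eventually_nhds_notMem_range_diff (hcly a)] with x h1 h2 hx
      by_contra hxa
      exact hx.elim (fun h => h1 ⟨h, hxa⟩) fun h => h2 ⟨h, hxa⟩
    obtain ⟨r, hr, s, hs, hdisc⟩ := h (range u ∪ range y)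
      (by
        refine isOpen_compl_iff.1 (isOpen_iff_mem_nhds.2 fun a ha => ?_)
        filter_upwards [hnhds a] with x hx hxA
        exact ha (hx hxA ▸ hxA))
      (fun a ha => by
        obtain ⟨U, hUsub, hU, haU⟩ := mem_nhds_iff.1 (hnhds a)
        exact ⟨U, hU, Subset.antisymm (fun x hx => hUsub hx.1 hx.2)
          (singleton_subset_iff.2 ⟨haU, ha⟩)⟩)
    obtain ⟨n, hn⟩ := (huy.eventually_mem (F.setOf_lt_M_mem_uniformityFilter hr.1 hs)).exists
    exact lt_asymm hn (hdisc (u n) (Or.inl ⟨n, rfl⟩) (y n) (Or.inr ⟨n, rfl⟩) (hne n).symm)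
  · let _ : TopologicalSpace X := F.topology
    refine h _ (IsOpen.isClosed_compl (isOpen_biUnion fun a _ => F.isOpen_ball a hr hs))
      fun a ha => F.exists_isOpen_inter_eq_singleton ha fun had => ha ?_
    exact mem_biUnion had (F.mem_ball_self a hr.1 hs)
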